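/- Fix γ̄ > 0 and ε̄ > 0. For ε ∈ (ε̄, (3/2)ε̄), let ν(ε) = (γ̄/(2ε̄))·(√(ε̄/(3ε̄ − 2ε)) − 1), and let C_WD(ε) denote the ergodic capacity E[(1/2)log₂(1+γ_s)] of the weighted difference scheme with weight ν(ε), where γ₁, γ₂ are i.i.d. with density (2/γ̄)e^{−2x/γ̄}, ε₁, ε₂ are i.i.d. exponential with mean ε̄, all independent, and s = 1 if γ₁ − γ₂ > ν(ε)(ε₂ − ε₁), s = 2 otherwise (so the scheme's average energy transfer equals ε). Then C_WD is strictly concave on (ε̄, (3/2)ε̄): its second derivative with respect to ε is negative throughout. (Corollary 3: the capacity–energy tradeoff of the weighted difference scheme has increasing opportunity cost.) -/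

import Mathlib

open MeasureTheory ProbabilityTheory Real

/-- The joint law of `(γ₁, γ₂, ε₁, ε₂)`: `γ₁, γ₂` are i.i.d. with density
`(2/γ̄)e^{-2x/γ̄}` on `(0,∞)` (exponential with rate `2/γ̄`), `ε₁, ε₂` are i.i.d.
exponential with mean `ε̄` (rate `1/ε̄`), and all four are mutually independent.
A sample point `ω` has `ω.1 = γ₁`, `ω.2.1 = γ₂`, `ω.2.2.1 = ε₁`, `ω.2.2.2 = ε₂`. -/
noncomputable def wdMeasure (γbar εbar : ℝ) : Measure (ℝ × ℝ × ℝ × ℝ) :=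
  (expMeasure (2 / γbar)).prod
    ((expMeasure (2 / γbar)).prod ((expMeasure (1 / εbar)).prod (expMeasure (1 / εbar))))

open Set Filter Topology

lemma measurable_exponentialPDF (r : ℝ) : Measurable (exponentialPDF r) :=
  (measurable_exponentialPDFReal r).ennreal_ofReal

lemma integral_expMeasure {r : ℝ} (hr : 0 < r) (g : ℝ → ℝ) :
    ∫ x, g x ∂(expMeasure r) = ∫ x in Ioi 0, r * exp (-(r * x)) * g x := by
  have h : expMeasure r = volume.withDensity (exponentialPDF r) := rfl
  rw [h, integral_withDensity_eq_integral_toReal_smul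
    (measurable_exponentialPDF r)
    (ae_of_all _ fun _ => ENNReal.ofReal_lt_top),
    ← integral_Ici_eq_integral_Ioi, ← integral_indicator measurableSet_Ici]
  refine integral_congr_ae (ae_of_all _ fun x => ?_)
  by_cases hx : 0 ≤ x
  · have : 0 ≤ r * exp (-(r * x)) := by positivity
    simp [exponentialPDF_of_nonneg hx, hx, ENNReal.toReal_ofReal this]
  · simp [exponentialPDF_of_neg (not_le.1 hx), hx]

lemma ae_pos_expMeasure (r : ℝ) : ∀ᵐ x ∂(expMeasure r), 0 < x := by
  have h : expMeasure r = volume.withDensity (exponentialPDF r) := rfl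
  have h0 : ∀ᵐ x : ℝ, x ≠ 0 := by simp [ae_iff]
  rw [h, ae_withDensity_iff (measurable_exponentialPDF r)]
  filter_upwards [h0] with x hx h
  by_contra hn
  exact h (exponentialPDF_of_neg (lt_of_le_of_ne (not_lt.1 hn) hx))

lemma integrable_id_expMeasure {r : ℝ} (hr : 0 < r) :
    Integrable (fun x : ℝ => x) (expMeasure r) := by
  have h : expMeasure r = volume.withDensity (exponentialPDF r) := rfl
  rw [h, integrable_withDensity_iff_integrable_smul'
    (measurable_exponentialPDF r)
    (ae_of_all _ fun _ => ENNReal.ofReal_lt_top)]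
  have h1 := (integrableOn_rpow_mul_exp_neg_mul_rpow (p := 1) (s := 1) (b := r)
    (by norm_num) one_pos hr).const_mul r
  refine ((integrable_indicator_iff measurableSet_Ioi).2 h1).congr (ae_of_all _ fun x => ?_)
  rcases lt_trichotomy 0 x with hx | rfl | hx
  · have : 0 ≤ r * exp (-(r * x)) := by positivity
    simp [exponentialPDF_of_nonneg hx.le, hx, ENNReal.toReal_ofReal this]
    ring
  · simp
  · simp [exponentialPDF_of_neg hx, hx.le]

/-- Memorylessness of the exponential law. -/
lemma integral_indicator_expMeasure {r s : ℝ} (hr : 0 < r) (hs : 0 ≤ s) {S : Set ℝ}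
    (hS : MeasurableSet S) (hS' : S =ᵐ[volume] Ioi s) (g : ℝ → ℝ) :
    ∫ x, S.indicator g x ∂(expMeasure r) =
      exp (-(r * s)) * ∫ x, g (s + x) ∂(expMeasure r) := by
  have hmul : ∀ x, r * exp (-(r * x)) * S.indicator g x =
      S.indicator (fun x => r * exp (-(r * x)) * g x) x := fun x => by
    by_cases hx : x ∈ S <;> simp [hx]
  rw [integral_expMeasure hr, integral_expMeasure hr]
  simp_rw [hmul]
  rw [setIntegral_indicator hS, setIntegral_congr_set (t := Ioi s), ← integral_const_mul]
  · rw [← integral_indicator measurableSet_Ioi, ← integral_indicator measurableSet_Ioi,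
      ← integral_add_left_eq_self _ s]
    refine integral_congr_ae (ae_of_all _ fun x => ?_)
    by_cases hx : 0 < x
    · simp only [indicator, mem_Ioi, hx, if_true, lt_add_iff_pos_right]
      rw [mul_add, neg_add, exp_add]
      ring
    · simp [indicator, hx]
  · have h2 : (Ioi 0 : Set ℝ) ∩ Ioi s = Ioi s := by
      rw [Ioi_inter_Ioi]; simp [hs]
    have h3 : (Ioi 0 ∩ S : Set ℝ) =ᵐ[volume] (Ioi 0 ∩ Ioi s : Set ℝ) :=
      EventuallyEq.rfl.inter hS'
    rwa [h2] at h3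

/-- Exponential tilting followed by rescaling. -/
lemma integral_exp_mul_expMeasure {r a w : ℝ} (hr : 0 < r) (hw : 0 < w)
    (haw : (a + r) * w = r) (h : ℝ → ℝ) :
    ∫ x, exp (-(a * x)) * h x ∂(expMeasure r) = w * ∫ z, h (w * z) ∂(expMeasure r) := by
  rw [integral_expMeasure hr, integral_expMeasure hr]
  have := integral_comp_mul_left_Ioi' (fun x => r * exp (-(r * x)) * (exp (-(a * x)) * h x)) 0 hw
  rw [mul_zero] at this
  rw [← this, smul_eq_mul]
  congr 2
  ext z
  rw [← mul_assoc, mul_assoc r, ← exp_add]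
  congr 3
  linear_combination (-z) * haw

lemma integral_prod_gap {r t : ℝ} (hr : 0 < r) (ht : 0 ≤ t) {T : Set ℝ} (hT : MeasurableSet T)
    (hT' : ∀ x : ℝ, {y | y - x ∈ T} =ᵐ[volume] Ioi (x + t)) :
    ∫ p : ℝ × ℝ, T.indicator 1 (p.2 - p.1) ∂((expMeasure r).prod (expMeasure r)) =
      exp (-(r * t)) / 2 := by
  have := isProbabilityMeasure_expMeasure hr
  have hm : Measurable fun p : ℝ × ℝ => T.indicator (1 : ℝ → ℝ) (p.2 - p.1) :=
    (measurable_one.indicator hT).comp (by fun_prop)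
  rw [integral_prod]
  · have h1 : ∀ᵐ x ∂(expMeasure r), ∫ y, T.indicator (1 : ℝ → ℝ) (y - x) ∂(expMeasure r) =
        exp (-(r * x)) * exp (-(r * t)) := by
      filter_upwards [ae_pos_expMeasure r] with x hx
      have := integral_indicator_expMeasure hr (by positivity : 0 ≤ x + t)
        (S := {y | y - x ∈ T}) (hT.preimage (by fun_prop)) (hT' x) 1
      rw [show (fun y => T.indicator (1 : ℝ → ℝ) (y - x)) =
        fun y => ({y | y - x ∈ T} : Set ℝ).indicator 1 y from rfl, this, ← exp_add]
      simp
      ring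
    rw [integral_congr_ae h1, integral_exp_mul_expMeasure hr (w := 1 / 2) (by norm_num) (by ring)]
    simp
    ring
  · refine Integrable.of_bound hm.aestronglyMeasurable 1 (ae_of_all _ fun p => ?_)
    by_cases h : p.2 - p.1 ∈ T <;> simp [h]

/-- The distribution function of a scaled difference of two i.i.d. exponential variables. -/
lemma integral_ite_gap {r v d : ℝ} (hr : 0 < r) (hv : 0 < v) :
    ∫ p : ℝ × ℝ, (if v * (p.2 - p.1) < d then (1 : ℝ) else 0)
        ∂((expMeasure r).prod (expMeasure r)) =
      if 0 ≤ d then 1 - exp (-(r / v * d)) / 2 else exp (-(r / v * -d)) / 2 := by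
  have := isProbabilityMeasure_expMeasure hr
  split_ifs with hd
  · have h := integral_prod_gap hr (div_nonneg hd hv.le) (T := Ici (d / v)) measurableSet_Ici
      fun x => by
        have : {y | y - x ∈ Ici (d / v)} = Ici (x + d / v) := by
          ext y; simp [le_sub_iff_add_le, add_comm]
        rw [this]; exact Ioi_ae_eq_Ici.symm
    have h1 : ∀ p : ℝ × ℝ, (if v * (p.2 - p.1) < d then (1 : ℝ) else 0) =
        1 - (Ici (d / v)).indicator 1 (p.2 - p.1) := fun p => by
      by_cases hp : v * (p.2 - p.1) < d
      · have : ¬ d / v ≤ p.2 - p.1 := by rw [div_le_iff₀ hv]; linarith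
        simp [hp, indicator, -not_le, this]
      · have : d / v ≤ p.2 - p.1 := by rw [div_le_iff₀ hv]; linarith
        simp [hp, indicator, this]
    simp_rw [h1]
    rw [integral_sub (integrable_const _), h]
    · simp
      ring_nf
    · refine Integrable.of_bound (Measurable.aestronglyMeasurable ?_) 1 (ae_of_all _ fun p => ?_)
      · exact (measurable_one.indicator measurableSet_Ici).comp (by fun_prop)
      · by_cases h : p.2 - p.1 ∈ Ici (d / v) <;> simp [indicator, h]
  · have h := integral_prod_gap hr (div_nonneg (by linarith : 0 ≤ -d) hv.le)
      (T := Ioi (-d / v)) measurableSet_Ioi fun x => by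
        have : {y | y - x ∈ Ioi (-d / v)} = Ioi (x + -d / v) := by
          ext y; simp [lt_sub_iff_add_lt, add_comm]
        rw [this]; exact EventuallyEq.rfl
    rw [← integral_prod_swap, show r / v * -d = r * (-d / v) by ring, ← h]
    refine integral_congr_ae (ae_of_all _ fun p => ?_)
    by_cases hp : v * (p.1 - p.2) < d
    · have : -d / v < p.2 - p.1 := by rw [div_lt_iff₀ hv]; linarith
      simp [hp, indicator, this]
    · have : ¬ -d / v < p.2 - p.1 := by rw [div_lt_iff₀ hv]; linarith
      simp [hp, indicator, this, -not_lt]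

lemma ae_pos_prod_expMeasure {r : ℝ} (hr : 0 < r) :
    ∀ᵐ p ∂((expMeasure r).prod (expMeasure r)), 0 < p.1 ∧ 0 < p.2 := by
  have := isProbabilityMeasure_expMeasure hr
  filter_upwards [Measure.quasiMeasurePreserving_fst.ae (ae_pos_expMeasure r),
    Measure.quasiMeasurePreserving_snd.ae (ae_pos_expMeasure r)] with p h1 h2
  exact ⟨h1, h2⟩

lemma integrable_const_mul_add_expMeasure {r : ℝ} (hr : 0 < r) (c : ℝ) :
    Integrable (fun p : ℝ × ℝ => c * (p.1 + p.2)) ((expMeasure r).prod (expMeasure r)) := by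
  have := isProbabilityMeasure_expMeasure hr
  exact (((integrable_id_expMeasure hr).comp_fst _).add
    ((integrable_id_expMeasure hr).comp_snd _)).const_mul c

lemma integrable_prod_expMeasure {r : ℝ} (hr : 0 < r) (c : ℝ) {F : ℝ × ℝ → ℝ}
    (hF : Measurable F) (hb : ∀ p : ℝ × ℝ, 0 < p.1 → 0 < p.2 → |F p| ≤ c * (p.1 + p.2)) :
    Integrable F ((expMeasure r).prod (expMeasure r)) := by
  refine (integrable_const_mul_add_expMeasure hr c).mono' hF.aestronglyMeasurable ?_
  filter_upwards [ae_pos_prod_expMeasure hr] with p hp using hb p hp.1 hp.2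

lemma log_one_add_nonneg {x : ℝ} (hx : 0 < x) : 0 ≤ log (1 + x) := log_nonneg (by linarith)

lemma log_one_add_le {x : ℝ} (hx : 0 < x) : log (1 + x) ≤ x := by
  have := log_le_sub_one_of_pos (by linarith : 0 < 1 + x)
  linarith

lemma abs_log_sub_log_le {x y : ℝ} (hx : 0 < x) (hy : 0 < y) :
    |log (1 + x) - log (1 + y)| ≤ x + y := by
  have h1 := log_one_add_nonneg hx
  have h2 := log_one_add_nonneg hy
  have h3 := log_one_add_le hx
  have h4 := log_one_add_le hy
  rw [abs_le]
  constructor <;> linarith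

/-- The integrand of the capacity loss relative to always selecting the stronger relay. -/
noncomputable def lossKernel (r w : ℝ) (p : ℝ × ℝ) : ℝ :=
  exp (-(r * p.1)) * (w * (log (1 + p.1 + w * p.2) - log (1 + p.1)))

lemma measurable_lossKernel (r w : ℝ) : Measurable (lossKernel r w) := by
  unfold lossKernel
  fun_prop

lemma log_ratio_nonneg {y z w : ℝ} (hw : 0 < w) (hy : 0 < y) (hz : 0 < z) :
    0 ≤ log (1 + y + w * z) - log (1 + y) := by
  have : 0 < w * z := by positivity
  exact sub_nonneg.2 (log_le_log (by linarith) (by linarith))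

lemma log_ratio_le {y z w : ℝ} (hw : 0 < w) (hy : 0 < y) (hz : 0 < z) :
    log (1 + y + w * z) - log (1 + y) ≤ w * z := by
  have h : 0 < w * z := by positivity
  rw [← log_div (by positivity) (by positivity)]
  refine (log_le_sub_one_of_pos (by positivity)).trans ?_
  rw [div_sub_one (by positivity), div_le_iff₀ (by positivity)]
  nlinarith

lemma integrable_lossKernel {r w : ℝ} (hr : 0 < r) (hw : 0 < w) :
    Integrable (lossKernel r w) ((expMeasure r).prod (expMeasure r)) := by
  refine integrable_prod_expMeasure hr (w * w) (measurable_lossKernel r w) fun p h1 h2 => ?_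
  have h3 := log_ratio_nonneg hw h1 h2
  have h4 := log_ratio_le hw h1 h2
  have h5 : exp (-(r * p.1)) ≤ 1 := exp_le_one_iff.2 (by nlinarith)
  rw [lossKernel, abs_of_nonneg (by positivity)]
  calc _ ≤ 1 * (w * (w * p.2)) := by gcongr
    _ ≤ _ := by nlinarith [mul_pos (mul_pos hw hw) h1]

/-- The contribution to the loss of the event that the first relay is the stronger one. -/
noncomputable def upperLoss (a : ℝ) (p : ℝ × ℝ) : ℝ :=
  if p.2 < p.1 then (log (1 + p.1) - log (1 + p.2)) * exp (-(a * (p.1 - p.2))) else 0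

lemma integrable_upperLoss {r a : ℝ} (hr : 0 < r) (ha : 0 < a) :
    Integrable (upperLoss a) ((expMeasure r).prod (expMeasure r)) := by
  refine integrable_prod_expMeasure hr 1
    (Measurable.ite (measurableSet_lt (by fun_prop) (by fun_prop)) (by fun_prop) (by fun_prop))
    fun p h1 h2 => ?_
  rw [upperLoss]
  split_ifs with h
  · have h5 : exp (-(a * (p.1 - p.2))) ≤ 1 := exp_le_one_iff.2 (by nlinarith)
    rw [abs_mul, abs_of_nonneg (exp_pos _).le, mul_comm]
    gcongr
    exact abs_log_sub_log_le h1 h2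
  · rw [abs_zero]; linarith

lemma integral_upperLoss {r a w : ℝ} (hr : 0 < r) (ha : 0 < a) (hw : 0 < w)
    (haw : (a + r) * w = r) :
    ∫ p, upperLoss a p ∂((expMeasure r).prod (expMeasure r)) =
      ∫ p, lossKernel r w p ∂((expMeasure r).prod (expMeasure r)) := by
  have := isProbabilityMeasure_expMeasure hr
  rw [integral_prod_symm _ (integrable_upperLoss hr ha),
    integral_prod _ (integrable_lossKernel hr hw)]
  refine integral_congr_ae ?_
  filter_upwards [ae_pos_expMeasure r] with y hy
  have h := integral_indicator_expMeasure hr hy.le (S := Ioi y) measurableSet_Ioi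
    EventuallyEq.rfl fun x => (log (1 + x) - log (1 + y)) * exp (-(a * (x - y)))
  have h2 := integral_exp_mul_expMeasure hr hw haw fun x => log (1 + y + x) - log (1 + y)
  have h3 : (fun x => upperLoss a (x, y)) = (Ioi y).indicator
      fun x => (log (1 + x) - log (1 + y)) * exp (-(a * (x - y))) := by
    ext x
    simp [upperLoss, indicator]
  rw [h3, h]
  simp_rw [lossKernel]
  rw [integral_const_mul, integral_const_mul, ← h2]
  congr 2
  ext x
  rw [add_sub_cancel_left, add_assoc, mul_comm]

/-- The integrand obtained by always selecting the stronger relay. -/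
noncomputable def bestRelay (p : ℝ × ℝ) : ℝ :=
  log (1 + p.2) + if 0 ≤ p.1 - p.2 then log (1 + p.1) - log (1 + p.2) else 0

lemma integrable_bestRelay {r : ℝ} (hr : 0 < r) :
    Integrable bestRelay ((expMeasure r).prod (expMeasure r)) := by
  refine integrable_prod_expMeasure hr 2 (Measurable.add (by fun_prop)
    (Measurable.ite (measurableSet_le (by fun_prop) (by fun_prop)) (by fun_prop) (by fun_prop)))
    fun p h1 h2 => ?_
  rw [bestRelay]
  refine (abs_add_le _ _).trans ?_
  have h3 := abs_log_sub_log_le h1 h2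
  have h4 := log_one_add_le h2
  rw [abs_of_nonneg (log_one_add_nonneg h2)]
  split_ifs with h
  · linarith
  · rw [abs_zero]; linarith

lemma integral_log_selected {r m v w : ℝ} (hr : 0 < r) (hm : 0 < m) (hv : 0 < v) (hw : 0 < w)
    (haw : (m / v + r) * w = r) :
    ∫ ω : ℝ × ℝ × ℝ × ℝ,
        log (1 + (if v * (ω.2.2.2 - ω.2.2.1) < ω.1 - ω.2.1 then ω.1 else ω.2.1))
        ∂((expMeasure r).prod ((expMeasure r).prod ((expMeasure m).prod (expMeasure m)))) =
      (∫ p, bestRelay p ∂((expMeasure r).prod (expMeasure r))) -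
        ∫ p, lossKernel r w p ∂((expMeasure r).prod (expMeasure r)) := by
  have := isProbabilityMeasure_expMeasure hr
  have := isProbabilityMeasure_expMeasure hm
  rw [← Measure.prodAssoc_prod, integral_map_equiv, integral_prod]
  · set a := m / v with ha_def
    have ha : 0 < a := div_pos hm hv
    have key : ∀ p : ℝ × ℝ, ∫ q : ℝ × ℝ,
        log (1 + (if v * (q.2 - q.1) < p.1 - p.2 then p.1 else p.2))
          ∂((expMeasure m).prod (expMeasure m)) =
        bestRelay p - (upperLoss a p / 2 + upperLoss a p.swap / 2) := fun p => by
      have h1 : ∀ q : ℝ × ℝ,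
          log (1 + (if v * (q.2 - q.1) < p.1 - p.2 then p.1 else p.2)) = log (1 + p.2) +
            (log (1 + p.1) - log (1 + p.2)) *
              (if v * (q.2 - q.1) < p.1 - p.2 then (1 : ℝ) else 0) := fun q => by
        split_ifs <;> ring
      simp_rw [h1]
      rw [integral_add (integrable_const _), integral_const_mul, integral_ite_gap hm hv]
      · rw [← ha_def, bestRelay, upperLoss, upperLoss]
        simp only [Prod.fst_swap, Prod.snd_swap]
        rcases lt_trichotomy p.1 p.2 with h | h | h
        · have h' : ¬ (0 ≤ p.1 - p.2) := by linarith
          rw [if_neg h', if_neg h', if_neg h.not_gt, if_pos h, neg_sub]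
          simp
          ring
        · simp [h]
        · have h' : 0 ≤ p.1 - p.2 := by linarith
          rw [if_pos h', if_pos h', if_pos h, if_neg h.not_gt]
          simp
          ring
      · refine Integrable.const_mul (Integrable.of_bound (Measurable.aestronglyMeasurable ?_) 1
          (ae_of_all _ fun q => ?_)) _
        · exact Measurable.ite (measurableSet_lt (by fun_prop) (by fun_prop)) (by fun_prop)
            (by fun_prop)
        · split_ifs <;> simp
    simp only [MeasurableEquiv.prodAssoc, MeasurableEquiv.coe_mk, Equiv.prodAssoc_apply]
    simp_rw [key]
    have hu := (integrable_upperLoss hr ha).div_const 2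
    have hu' : Integrable (fun p => upperLoss a p.swap / 2)
      ((expMeasure r).prod (expMeasure r)) := hu.swap
    have hsum : Integrable (fun p => upperLoss a p / 2 + upperLoss a p.swap / 2)
      ((expMeasure r).prod (expMeasure r)) := hu.add hu'
    rw [integral_sub (integrable_bestRelay hr) hsum, integral_add hu hu',
      integral_prod_swap (fun p => upperLoss a p / 2), integral_div,
      integral_upperLoss hr ha hw haw, add_halves]
  · simp only [MeasurableEquiv.prodAssoc, MeasurableEquiv.coe_mk, Equiv.prodAssoc_apply]
    refine ((integrable_const_mul_add_expMeasure hr 1).comp_fst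
      ((expMeasure m).prod (expMeasure m))).mono' (Measurable.aestronglyMeasurable ?_) ?_
    · refine measurable_log.comp (measurable_const.add ?_)
      exact Measurable.ite (measurableSet_lt (by fun_prop) (by fun_prop)) (by fun_prop)
        (by fun_prop)
    · filter_upwards [Measure.quasiMeasurePreserving_fst.ae (ae_pos_prod_expMeasure hr)]
        with p ⟨h1, h2⟩
      have h3 := log_one_add_le h1
      have h4 := log_one_add_le h2
      rw [norm_eq_abs]
      split_ifs
      · rw [abs_of_nonneg (log_one_add_nonneg h1)]; linarith
      · rw [abs_of_nonneg (log_one_add_nonneg h2)]; linarith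

/-- The derivative of `lossKernel` in its second argument. -/
noncomputable def lossKernelDeriv (r w : ℝ) (p : ℝ × ℝ) : ℝ :=
  exp (-(r * p.1)) *
    ((log (1 + p.1 + w * p.2) - log (1 + p.1)) + w * (p.2 / (1 + p.1 + w * p.2)))

/-- The second derivative of `lossKernel` in its second argument. -/
noncomputable def lossKernelDerivTwo (r w : ℝ) (p : ℝ × ℝ) : ℝ :=
  exp (-(r * p.1)) *
    (p.2 / (1 + p.1 + w * p.2) + p.2 * (1 + p.1) / (1 + p.1 + w * p.2) ^ 2)

lemma hasDerivAt_log_ratio {y z w : ℝ} (hw : 0 < w) (hy : 0 < y) (hz : 0 < z) :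
    HasDerivAt (fun w => log (1 + y + w * z) - log (1 + y)) (z / (1 + y + w * z)) w := by
  have h : HasDerivAt (fun w => 1 + y + w * z) z w := by
    simpa using ((hasDerivAt_id w).mul_const z).const_add (1 + y)
  exact (h.log (by positivity)).sub_const _

lemma hasDerivAt_lossKernel (r : ℝ) {w : ℝ} (hw : 0 < w) {p : ℝ × ℝ} (h1 : 0 < p.1)
    (h2 : 0 < p.2) :
    HasDerivAt (fun w => lossKernel r w p) (lossKernelDeriv r w p) w := by
  have h := ((hasDerivAt_id w).mul (hasDerivAt_log_ratio hw h1 h2)).const_mul (exp (-(r * p.1)))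
  refine h.congr_deriv ?_
  simp [lossKernelDeriv]

lemma hasDerivAt_lossKernelDeriv (r : ℝ) {w : ℝ} (hw : 0 < w) {p : ℝ × ℝ} (h1 : 0 < p.1)
    (h2 : 0 < p.2) :
    HasDerivAt (fun w => lossKernelDeriv r w p) (lossKernelDerivTwo r w p) w := by
  have h : HasDerivAt (fun w => 1 + p.1 + w * p.2) p.2 w := by
    simpa using ((hasDerivAt_id w).mul_const p.2).const_add (1 + p.1)
  have hpos : 1 + p.1 + w * p.2 ≠ 0 := by positivity
  have h3 := ((hasDerivAt_log_ratio hw h1 h2).add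
    ((hasDerivAt_id w).mul ((hasDerivAt_const w p.2).div h hpos))).const_mul (exp (-(r * p.1)))
  refine h3.congr_deriv ?_
  simp only [lossKernelDerivTwo, id, Pi.div_apply]
  congr 1
  field_simp
  ring

lemma lossKernelDeriv_pos (r : ℝ) {w : ℝ} (hw : 0 < w) {p : ℝ × ℝ} (h1 : 0 < p.1)
    (h2 : 0 < p.2) : 0 < lossKernelDeriv r w p := by
  have := log_ratio_nonneg hw h1 h2
  unfold lossKernelDeriv
  positivity

lemma lossKernelDerivTwo_nonneg (r : ℝ) {w : ℝ} (hw : 0 < w) {p : ℝ × ℝ} (h1 : 0 < p.1)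
    (h2 : 0 < p.2) : 0 ≤ lossKernelDerivTwo r w p := by
  unfold lossKernelDerivTwo
  positivity

lemma lossKernelDeriv_le {r w : ℝ} (hr : 0 < r) (hw : 0 < w) (hw1 : w < 1) {p : ℝ × ℝ}
    (h1 : 0 < p.1) (h2 : 0 < p.2) : lossKernelDeriv r w p ≤ 2 * (p.1 + p.2) := by
  have h3 := log_ratio_nonneg hw h1 h2
  have h4 := log_ratio_le hw h1 h2
  have h5 : exp (-(r * p.1)) ≤ 1 := exp_le_one_iff.2 (by nlinarith)
  have h6 : 0 < w * p.2 := by positivity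
  have h7 : p.2 / (1 + p.1 + w * p.2) ≤ p.2 := div_le_self h2.le (by linarith)
  unfold lossKernelDeriv
  calc _ ≤ 1 * (w * p.2 + w * p.2) := by gcongr
    _ ≤ _ := by nlinarith

lemma lossKernelDerivTwo_le {r w : ℝ} (hr : 0 < r) (hw : 0 < w) {p : ℝ × ℝ}
    (h1 : 0 < p.1) (h2 : 0 < p.2) : lossKernelDerivTwo r w p ≤ 2 * (p.1 + p.2) := by
  have h5 : exp (-(r * p.1)) ≤ 1 := exp_le_one_iff.2 (by nlinarith)
  have h6 : 0 < w * p.2 := by positivity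
  have h7 : p.2 / (1 + p.1 + w * p.2) ≤ p.2 := div_le_self h2.le (by linarith)
  have h8 : p.2 * (1 + p.1) / (1 + p.1 + w * p.2) ^ 2 ≤ p.2 := by
    rw [div_le_iff₀ (by positivity)]
    have : 1 + p.1 ≤ (1 + p.1 + w * p.2) ^ 2 := by nlinarith
    gcongr
  unfold lossKernelDerivTwo
  calc _ ≤ 1 * (p.2 + p.2) := by gcongr
    _ ≤ _ := by linarith

/-- The mean loss as a function of the reparametrized weight. -/
noncomputable def loss (r w : ℝ) : ℝ :=
  ∫ p, lossKernel r w p ∂((expMeasure r).prod (expMeasure r))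

/-- The derivative of `loss` in its second argument. -/
noncomputable def lossDeriv (r w : ℝ) : ℝ :=
  ∫ p, lossKernelDeriv r w p ∂((expMeasure r).prod (expMeasure r))

/-- The second derivative of `loss` in its second argument. -/
noncomputable def lossDerivTwo (r w : ℝ) : ℝ :=
  ∫ p, lossKernelDerivTwo r w p ∂((expMeasure r).prod (expMeasure r))

lemma measurable_lossKernelDeriv (r w : ℝ) : Measurable (lossKernelDeriv r w) := by
  unfold lossKernelDeriv
  fun_prop

lemma measurable_lossKernelDerivTwo (r w : ℝ) : Measurable (lossKernelDerivTwo r w) := by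
  unfold lossKernelDerivTwo
  fun_prop

lemma hasDerivAt_loss {r w : ℝ} (hr : 0 < r) (hw : w ∈ Ioo (0 : ℝ) 1) :
    Integrable (lossKernelDeriv r w) ((expMeasure r).prod (expMeasure r)) ∧
      HasDerivAt (loss r) (lossDeriv r w) w := by
  refine hasDerivAt_integral_of_dominated_loc_of_deriv_le (F := lossKernel r)
    (F' := lossKernelDeriv r) (bound := fun p => 2 * (p.1 + p.2)) (isOpen_Ioo.mem_nhds hw)
    (Eventually.of_forall fun w => (measurable_lossKernel r w).aestronglyMeasurable)
    (integrable_lossKernel hr hw.1) (measurable_lossKernelDeriv r w).aestronglyMeasurable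
    ?_ (integrable_const_mul_add_expMeasure hr 2) ?_
  · filter_upwards [ae_pos_prod_expMeasure hr] with p ⟨h1, h2⟩ x hx
    rw [norm_eq_abs, abs_of_nonneg (lossKernelDeriv_pos r hx.1 h1 h2).le]
    exact lossKernelDeriv_le hr hx.1 hx.2 h1 h2
  · filter_upwards [ae_pos_prod_expMeasure hr] with p ⟨h1, h2⟩ x hx
    exact hasDerivAt_lossKernel r hx.1 h1 h2

lemma hasDerivAt_lossDeriv {r w : ℝ} (hr : 0 < r) (hw : w ∈ Ioo (0 : ℝ) 1) :
    HasDerivAt (lossDeriv r) (lossDerivTwo r w) w := by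
  refine (hasDerivAt_integral_of_dominated_loc_of_deriv_le (F := lossKernelDeriv r)
    (F' := lossKernelDerivTwo r) (bound := fun p => 2 * (p.1 + p.2)) (isOpen_Ioo.mem_nhds hw)
    (Eventually.of_forall fun w => (measurable_lossKernelDeriv r w).aestronglyMeasurable)
    (hasDerivAt_loss hr hw).1 (measurable_lossKernelDerivTwo r w).aestronglyMeasurable
    ?_ (integrable_const_mul_add_expMeasure hr 2) ?_).2
  · filter_upwards [ae_pos_prod_expMeasure hr] with p ⟨h1, h2⟩ x hx
    rw [norm_eq_abs, abs_of_nonneg (lossKernelDerivTwo_nonneg r hx.1 h1 h2)]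
    exact lossKernelDerivTwo_le hr hx.1 h1 h2
  · filter_upwards [ae_pos_prod_expMeasure hr] with p ⟨h1, h2⟩ x hx
    exact hasDerivAt_lossKernelDeriv r hx.1 h1 h2

lemma lossDeriv_pos {r w : ℝ} (hr : 0 < r) (hw : w ∈ Ioo (0 : ℝ) 1) : 0 < lossDeriv r w := by
  have := isProbabilityMeasure_expMeasure hr
  have hpos : ∀ᵐ p ∂((expMeasure r).prod (expMeasure r)), 0 < lossKernelDeriv r w p := by
    filter_upwards [ae_pos_prod_expMeasure hr] with p ⟨h1, h2⟩
    exact lossKernelDeriv_pos r hw.1 h1 h2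
  have hnn : 0 ≤ᵐ[(expMeasure r).prod (expMeasure r)] lossKernelDeriv r w :=
    hpos.mono fun p hp => hp.le
  rw [lossDeriv, integral_pos_iff_support_of_nonneg_ae hnn (hasDerivAt_loss hr hw).1]
  have : Function.support (lossKernelDeriv r w) =ᵐ[(expMeasure r).prod (expMeasure r)] univ :=
    eventuallyEq_univ.2 (hpos.mono fun p hp => hp.ne')
  rw [measure_congr this, measure_univ]
  exact one_pos

lemma lossDerivTwo_nonneg {r w : ℝ} (hr : 0 < r) (hw : 0 < w) : 0 ≤ lossDerivTwo r w := by
  refine integral_nonneg_of_ae ?_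
  filter_upwards [ae_pos_prod_expMeasure hr] with p ⟨h1, h2⟩
  exact lossKernelDerivTwo_nonneg r hw h1 h2

/-- The loss parameter as a function of the average energy transfer. -/
noncomputable def lossParam (e x : ℝ) : ℝ := 1 - √(3 - 2 * x / e)

lemma radicand_mem_Ioo {e x : ℝ} (he : 0 < e) (hx : x ∈ Ioo e (3 / 2 * e)) :
    3 - 2 * x / e ∈ Ioo (0 : ℝ) 1 := by
  have h1 : 2 * x / e < 3 := by rw [div_lt_iff₀ he]; linarith [hx.2]
  have h2 : 2 < 2 * x / e := by rw [lt_div_iff₀ he]; linarith [hx.1]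
  constructor <;> linarith

lemma lossParam_mem_Ioo {e x : ℝ} (he : 0 < e) (hx : x ∈ Ioo e (3 / 2 * e)) :
    lossParam e x ∈ Ioo (0 : ℝ) 1 := by
  have h := radicand_mem_Ioo he hx
  have h1 : 0 < √(3 - 2 * x / e) := sqrt_pos.2 h.1
  have h2 : √(3 - 2 * x / e) < 1 := by rw [sqrt_lt' one_pos]; linarith [h.2]
  rw [lossParam]
  constructor <;> linarith

lemma hasDerivAt_sqrt_radicand {e x : ℝ} (he : 0 < e) (hx : x ∈ Ioo e (3 / 2 * e)) :
    HasDerivAt (fun x => √(3 - 2 * x / e)) (-(e * √(3 - 2 * x / e))⁻¹) x := by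
  have h := radicand_mem_Ioo he hx
  have h1 : HasDerivAt (fun x => 3 - 2 * x / e) (-(2 / e)) x := by
    simpa using (((hasDerivAt_id x).const_mul 2).div_const e).const_sub 3
  refine (h1.sqrt h.1.ne').congr_deriv ?_
  have h2 : 0 < √(3 - 2 * x / e) := sqrt_pos.2 h.1
  field_simp

lemma hasDerivAt_lossParam {e x : ℝ} (he : 0 < e) (hx : x ∈ Ioo e (3 / 2 * e)) :
    HasDerivAt (lossParam e) (e * √(3 - 2 * x / e))⁻¹ x := by
  simpa [lossParam] using! (hasDerivAt_sqrt_radicand he hx).const_sub 1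

lemma hasDerivAt_lossParam_deriv {e x : ℝ} (he : 0 < e) (hx : x ∈ Ioo e (3 / 2 * e)) :
    HasDerivAt (fun x => (e * √(3 - 2 * x / e))⁻¹) (e * √(3 - 2 * x / e) ^ 3 * e)⁻¹ x := by
  have h2 : 0 < √(3 - 2 * x / e) := sqrt_pos.2 (radicand_mem_Ioo he hx).1
  refine (((hasDerivAt_sqrt_radicand he hx).const_mul e).inv (by positivity)).congr_deriv ?_
  field_simp

lemma weight_spec {g e x v : ℝ} (hg : 0 < g) (he : 0 < e) (hx : x ∈ Ioo e (3 / 2 * e))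
    (hv : v = (g / (2 * e)) * (√(e / (3 * e - 2 * x)) - 1)) :
    0 < v ∧ (1 / e / v + 2 / g) * lossParam e x = 2 / g := by
  have h := lossParam_mem_Ioo he hx
  have hr : e / (3 * e - 2 * x) = (3 - 2 * x / e)⁻¹ := by
    have := (radicand_mem_Ioo he hx).1.ne'
    have h3 : 3 * e - 2 * x ≠ 0 := by linarith [hx.2]
    field_simp
  rw [hr, sqrt_inv] at hv
  rw [lossParam] at h ⊢
  set u := √(3 - 2 * x / e)
  have hu : 0 < u := by linarith [h.2]
  have hu1 : 0 < 1 - u := h.1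
  have hv' : v = g * (1 - u) / (2 * e * u) := by rw [hv]; field_simp
  refine ⟨by rw [hv']; positivity, ?_⟩
  rw [hv']
  field_simp
  ring

/-- Corollary 3: the capacity–energy tradeoff of the weighted difference scheme has
increasing opportunity cost.  With the weight `ν(ε) = (γ̄/(2ε̄))(√(ε̄/(3ε̄-2ε)) - 1)`
chosen so that the average energy transfer equals `ε`, the ergodic capacity `C_WD(ε)`
is strictly concave in `ε` on `(ε̄, (3/2)ε̄)` and its second derivative is negative
throughout this interval. -/
theorem weightedDifference_concave (γbar εbar : ℝ) (hγ : 0 < γbar) (hε : 0 < εbar)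
    (ν : ℝ → ℝ)
    (hν : ∀ ε, ν ε = (γbar / (2 * εbar)) * (Real.sqrt (εbar / (3 * εbar - 2 * ε)) - 1))
    (C : ℝ → ℝ)
    (hC : ∀ ε, C ε = ∫ ω, (1 / 2) *
        (Real.log (1 + (if ν ε * (ω.2.2.2 - ω.2.2.1) < ω.1 - ω.2.1 then ω.1 else ω.2.1))
          / Real.log 2) ∂(wdMeasure γbar εbar)) :
    StrictConcaveOn ℝ (Set.Ioo εbar (3 / 2 * εbar)) C ∧
      ∀ ε ∈ Set.Ioo εbar (3 / 2 * εbar), deriv (deriv C) ε < 0 := by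
  set I := Ioo εbar (3 / 2 * εbar)
  set r := 2 / γbar
  have hr : 0 < r := by positivity
  set K := ∫ p, bestRelay p ∂((expMeasure r).prod (expMeasure r))
  set c := 1 / (2 * log 2)
  have hc : 0 < c := by have := log_pos one_lt_two; positivity
  have hCeq : ∀ x ∈ I, C x = c * (K - loss r (lossParam εbar x)) := fun x hx => by
    obtain ⟨hv, hw⟩ := weight_spec hγ hε hx (hν x)
    rw [hC, loss, ← integral_log_selected hr (by positivity) hv (lossParam_mem_Ioo hε hx).1 hw,
      ← integral_const_mul, wdMeasure]
    congr 1
    ext ω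
    ring
  set C1 : ℝ → ℝ := fun x =>
    c * -(lossDeriv r (lossParam εbar x) * (εbar * √(3 - 2 * x / εbar))⁻¹)
  have hI : IsOpen I := isOpen_Ioo
  have hD1 : ∀ x ∈ I, HasDerivAt C (C1 x) x := fun x hx => by
    have h := ((hasDerivAt_loss hr (lossParam_mem_Ioo hε hx)).2.comp x
      (hasDerivAt_lossParam hε hx)).const_sub K |>.const_mul c
    exact h.congr_of_eventuallyEq (by filter_upwards [hI.mem_nhds hx] with y hy using hCeq y hy)
  have hneg : ∀ x ∈ I, deriv (deriv C) x < 0 := fun x hx => by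
    have hw := lossParam_mem_Ioo hε hx
    have h : HasDerivAt C1 _ x := (((hasDerivAt_lossDeriv hr hw).comp x (hasDerivAt_lossParam hε hx)).mul
      (hasDerivAt_lossParam_deriv hε hx)).neg.const_mul c
    have hev : deriv C =ᶠ[𝓝 x] C1 := by
      filter_upwards [hI.mem_nhds hx] with y hy using (hD1 y hy).deriv
    rw [hev.deriv_eq, h.deriv]
    have hs : 0 < √(3 - 2 * x / εbar) := sqrt_pos.2 (radicand_mem_Ioo hε hx).1
    have h1 := lossDeriv_pos hr hw
    have h2 := lossDerivTwo_nonneg hr hw.1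
    refine mul_neg_of_pos_of_neg hc (neg_neg_of_pos ?_)
    simp only [Function.comp]
    positivity
  exact ⟨strictConcaveOn_of_deriv2_neg' (convex_Ioo _ _)
    (fun x hx => (hD1 x hx).continuousAt.continuousWithinAt) hneg, hneg⟩
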